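/- Maximal function estimate in H^s for s>1 (Proposition 3.5): for every real s>1 there exists C>0 such that for every T ∈ (0,1) and every Schwartz function φ on ℝ³, ( ∫_ℝ ( sup_{(y,z)∈ℝ², t∈[0,T]} |U(t)φ(x,y,z)| )² dx )^{1/2} ≤ C ‖φ‖_{H^s(ℝ³)}. -/

import Mathlib

open MeasureTheory Real Filter
open scoped ENNReal

noncomputable section

/-- Euclidean dot product on ℝ³ (realized as ℝ × ℝ × ℝ). -/
def dot3 (a b : ℝ × ℝ × ℝ) : ℝ := a.1 * b.1 + a.2.1 * b.2.1 + a.2.2 * b.2.2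

/-- Euclidean norm on ℝ³. -/
def en3 (ξ : ℝ × ℝ × ℝ) : ℝ := Real.sqrt (dot3 ξ ξ)

/-- The Zakharov–Kuznetsov dispersion relation ω(ξ,η,μ) = ξ(ξ²+η²+μ²). -/
def omega3 (ξ : ℝ × ℝ × ℝ) : ℝ := ξ.1 * (ξ.1 ^ 2 + ξ.2.1 ^ 2 + ξ.2.2 ^ 2)

/-- Fourier transform on ℝ³, with normalization (2π)⁻³ ∫ e^{-i x·ξ} φ(x) dx. -/
def FT3 (φ : ℝ × ℝ × ℝ → ℂ) (ξ : ℝ × ℝ × ℝ) : ℂ :=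
  ((((2 * π) ^ 3)⁻¹ : ℝ) : ℂ) * ∫ x : ℝ × ℝ × ℝ, Complex.exp (-Complex.I * (dot3 x ξ : ℂ)) * φ x

/-- Inverse Fourier transform on ℝ³: ∫ e^{i x·ξ} g(ξ) dξ. -/
def invFT3 (g : ℝ × ℝ × ℝ → ℂ) (x : ℝ × ℝ × ℝ) : ℂ :=
  ∫ ξ : ℝ × ℝ × ℝ, Complex.exp (Complex.I * (dot3 x ξ : ℂ)) * g ξ

/-- The free Zakharov–Kuznetsov evolution U(t)φ(x̄) = ∫ e^{i(x̄·ξ̄ + tω(ξ̄))} φ̂(ξ̄) dξ̄. -/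
def U3 (φ : ℝ × ℝ × ℝ → ℂ) (t : ℝ) (x : ℝ × ℝ × ℝ) : ℂ :=
  ∫ ξ : ℝ × ℝ × ℝ, Complex.exp (Complex.I * ((dot3 x ξ + t * omega3 ξ : ℝ) : ℂ)) * FT3 φ ξ

/-- L² norm on ℝ³. -/
def L2norm3 (φ : ℝ × ℝ × ℝ → ℂ) : ℝ := Real.sqrt (∫ x : ℝ × ℝ × ℝ, ‖φ x‖ ^ 2)

/-- j-th coordinate of a point of ℝ³. -/
def coord3 (j : Fin 3) (ξ : ℝ × ℝ × ℝ) : ℝ := ![ξ.1, ξ.2.1, ξ.2.2] j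

/-- Littlewood–Paley ring cutoff δ_k(ξ̄) = p(2^{-k-1}ξ̄) − p(2^{-k}ξ̄) on ℝ³. -/
def delta3 (p : ℝ × ℝ × ℝ → ℝ) (k : ℤ) (ξ : ℝ × ℝ × ℝ) : ℝ :=
  p ((2:ℝ) ^ (-k-1) • ξ) - p ((2:ℝ) ^ (-k) • ξ)

/-- 1D rescaled cutoff p_k(ξ) = p(2^{-k}ξ). -/
def pk1 (p : ℝ → ℝ) (k : ℤ) (ξ : ℝ) : ℝ := p ((2:ℝ) ^ (-k) * ξ)

/-- 1D ring cutoff δ_k(ξ) = p(2^{-k-1}ξ) − p(2^{-k}ξ). -/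
def dk1 (p : ℝ → ℝ) (k : ℤ) (ξ : ℝ) : ℝ := p ((2:ℝ) ^ (-k-1) * ξ) - p ((2:ℝ) ^ (-k) * ξ)

/-- Oscillatory integral I with three 1D symbols:
I(t,x̄) = ∫ e^{i(x̄·ξ̄+tω(ξ̄))} ψ₁(ξ)ψ₂(η)ψ₃(μ) dξ̄. -/
def oscI (ψ₁ ψ₂ ψ₃ : ℝ → ℝ) (t : ℝ) (x : ℝ × ℝ × ℝ) : ℂ :=
  ∫ ξ : ℝ × ℝ × ℝ, Complex.exp (Complex.I * ((dot3 x ξ + t * omega3 ξ : ℝ) : ℂ)) *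
    ((ψ₁ ξ.1 * ψ₂ ξ.2.1 * ψ₃ ξ.2.2 : ℝ) : ℂ)

/-- The H^s norm ‖(1+|ξ̄|²)^{s/2} φ̂‖_{L²}. -/
def HsNorm (s : ℝ) (φ : ℝ × ℝ × ℝ → ℂ) : ℝ :=
  Real.sqrt (∫ ξ : ℝ × ℝ × ℝ, (1 + dot3 ξ ξ) ^ s * ‖FT3 φ ξ‖ ^ 2)

lemma integral_add_mul_I_eq {f : ℂ → ℂ} {σ C c : ℝ} (hc : 0 < c)
    (hf : ∀ x y : ℝ, y ∈ Set.uIcc 0 σ → DifferentiableAt ℂ f (x + y * Complex.I))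
    (hb : ∀ x y : ℝ, y ∈ Set.uIcc 0 σ → ‖f (x + y * Complex.I)‖ ≤ C * rexp (-c * x ^ 2)) :
    ∫ x : ℝ, f (x + σ * Complex.I) = ∫ x : ℝ, f x := by
  have h_int : ∀ y ∈ Set.uIcc 0 σ, Integrable fun x : ℝ => f (x + y * Complex.I) := by
    intro y hy
    have hcont : Continuous fun x : ℝ => f (x + y * Complex.I) :=
      continuous_iff_continuousAt.2 fun x =>
        ContinuousAt.comp (f := fun x : ℝ => (x + y * Complex.I : ℂ)) (hf x y hy).continuousAt
          (by fun_prop)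
    exact ((integrable_exp_neg_mul_sq hc).const_mul C).mono' hcont.aestronglyMeasurable
      (Eventually.of_forall fun x => hb x y hy)
  have hvert : ∀ x : ℝ, ‖∫ y : ℝ in (0 : ℝ)..σ, f (x + y * Complex.I)‖ ≤
      C * rexp (-c * x ^ 2) * |σ - 0| := fun x =>
    intervalIntegral.norm_integral_le_of_norm_le_const fun y hy =>
      hb x y (Set.uIoc_subset_uIcc hy)
  have hexp : Tendsto (fun x : ℝ => C * rexp (-c * x ^ 2) * |σ - 0|) atTop (nhds 0) := by
    have h1 : Tendsto (fun x : ℝ => rexp (-c * x ^ 2)) atTop (nhds 0) := by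
      refine Real.tendsto_exp_atBot.comp ?_
      exact (tendsto_pow_atTop (two_ne_zero)).const_mul_atTop_of_neg (neg_lt_zero.2 hc)
    simpa using (h1.const_mul C).mul_const |σ - 0|
  have hR : Tendsto (fun x : ℝ => ∫ y : ℝ in (0 : ℝ)..σ, f (x + y * Complex.I)) atTop (nhds 0) :=
    squeeze_zero_norm hvert hexp
  have hL : Tendsto (fun x : ℝ => ∫ y : ℝ in (0 : ℝ)..σ, f ((-x : ℝ) + y * Complex.I))
      atTop (nhds 0) :=
    squeeze_zero_norm (fun x => by simpa using hvert (-x)) hexp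
  have hrect : ∀ x : ℝ, (∫ u : ℝ in -x..x, f (u + σ * Complex.I)) =
      (∫ u : ℝ in -x..x, f u) + Complex.I * (∫ y : ℝ in (0 : ℝ)..σ, f (x + y * Complex.I)) -
        Complex.I * ∫ y : ℝ in (0 : ℝ)..σ, f ((-x : ℝ) + y * Complex.I) := by
    intro x
    have := Complex.integral_boundary_rect_eq_zero_of_differentiableOn f (-x : ℝ)
      (x + σ * Complex.I) (by
        intro ζ hζ
        have hm : ζ.im ∈ Set.uIcc 0 σ := by simpa using hζ.2
        have := hf ζ.re ζ.im hm
        rw [Complex.re_add_im] at this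
        exact this.differentiableWithinAt)
    simp at this
    push_cast
    linear_combination -this
  have h1 : Tendsto (fun x : ℝ => ∫ u : ℝ in -x..x, f (u + σ * Complex.I)) atTop
      (nhds (∫ x : ℝ, f (x + σ * Complex.I))) :=
    intervalIntegral_tendsto_integral (h_int σ Set.right_mem_uIcc) tendsto_neg_atTop_atBot tendsto_id
  have h0 : Tendsto (fun x : ℝ => ∫ u : ℝ in -x..x, f u) atTop (nhds (∫ x : ℝ, f x)) :=
    intervalIntegral_tendsto_integral (by simpa using h_int 0 Set.left_mem_uIcc)
      tendsto_neg_atTop_atBot tendsto_id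
  refine tendsto_nhds_unique h1 ?_
  simp_rw [hrect]
  simpa using (h0.add (hR.const_mul Complex.I)).sub (hL.const_mul Complex.I)

/-- The Gaussian-regularised propagator kernel. -/
def gaussKernel (l t : ℝ) (x : ℝ × ℝ × ℝ) : ℂ :=
  ∫ ξ : ℝ × ℝ × ℝ, Complex.exp (Complex.I * ((dot3 x ξ + t * omega3 ξ : ℝ) : ℂ)) *
    (rexp (-l * dot3 ξ ξ) : ℂ)

/-- The Gaussian kernel after integration in the two transverse frequencies,
as a holomorphic function of the remaining frequency. -/
def transverseProfile (l t x r : ℝ) (ζ : ℂ) : ℂ :=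
  Complex.exp (Complex.I * x * ζ + Complex.I * t * ζ ^ 3 - l * ζ ^ 2) *
    ((π / (l - Complex.I * t * ζ)) * Complex.exp (-r / (4 * (l - Complex.I * t * ζ))))

lemma integrable_exp_neg_mul_dot3 {l : ℝ} (hl : 0 < l) :
    Integrable fun ξ : ℝ × ℝ × ℝ => rexp (-l * dot3 ξ ξ) := by
  have h := integrable_exp_neg_mul_sq hl
  refine (h.mul_prod (h.mul_prod h)).congr (Eventually.of_forall fun ξ => ?_)
  simp only [dot3, ← Real.exp_add]
  congr 1
  ring

lemma continuous_dot3 : Continuous fun q : (ℝ × ℝ × ℝ) × (ℝ × ℝ × ℝ) => dot3 q.1 q.2 := by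
  unfold dot3; fun_prop

lemma continuous_omega3 : Continuous omega3 := by
  unfold omega3; fun_prop

lemma integrable_phase_mul {a : ℝ × ℝ × ℝ → ℂ} (ha : Integrable a) (t : ℝ) (x : ℝ × ℝ × ℝ) :
    Integrable fun ξ => Complex.exp (Complex.I * ((dot3 x ξ + t * omega3 ξ : ℝ) : ℂ)) * a ξ := by
  refine ha.bdd_mul (c := 1) ?_ (Eventually.of_forall fun ξ => ?_)
  · have := continuous_omega3
    have := continuous_dot3.comp (Continuous.prodMk_right x)
    refine Continuous.aestronglyMeasurable ?_
    simp only [Function.comp_def] at this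
    fun_prop
  · rw [mul_comm, Complex.norm_exp_ofReal_mul_I]

lemma gaussKernel_eq_integral_transverseProfile {l : ℝ} (hl : 0 < l) (t : ℝ) (x y z : ℝ) :
    gaussKernel l t (x, y, z) = ∫ ξ : ℝ, transverseProfile l t x (y ^ 2 + z ^ 2) ξ := by
  unfold gaussKernel
  rw [Measure.volume_eq_prod, integral_prod]
  · congr 1
    ext ξ
    have hb : 0 < (l - Complex.I * t * ξ : ℂ).re := by simpa using hl
    set b : ℂ := l - Complex.I * t * ξ with hbdef
    calc _ = ∫ w : ℝ × ℝ, Complex.exp (Complex.I * x * ξ + Complex.I * t * ξ ^ 3 - l * ξ ^ 2) *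
          ((Complex.exp (Complex.I * y * w.1) * Complex.exp (-b * w.1 ^ 2)) *
          (Complex.exp (Complex.I * z * w.2) * Complex.exp (-b * w.2 ^ 2))) := by
            congr 1
            ext w
            push_cast
            simp only [← Complex.exp_add, dot3, omega3, hbdef]
            congr 1
            push_cast
            ring
      _ = _ := by
            rw [integral_const_mul, Measure.volume_eq_prod, integral_prod_mul
              (fun η : ℝ => Complex.exp (Complex.I * y * η) * Complex.exp (-b * η ^ 2))
              (fun η : ℝ => Complex.exp (Complex.I * z * η) * Complex.exp (-b * η ^ 2)),
              fourierIntegral_gaussian hb, fourierIntegral_gaussian hb]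
            have hsq : (π / b : ℂ) ^ (1 / 2 : ℂ) * (π / b : ℂ) ^ (1 / 2 : ℂ) = π / b := by
              rw [← sq, one_div]
              exact Complex.cpow_nat_inv_pow _ two_ne_zero
            have hexp : Complex.exp (-(y : ℂ) ^ 2 / (4 * b)) * Complex.exp (-(z : ℂ) ^ 2 / (4 * b)) =
                Complex.exp (-((y ^ 2 + z ^ 2 : ℝ) : ℂ) / (4 * b)) := by
              rw [← Complex.exp_add]
              congr 1
              push_cast
              ring
            rw [transverseProfile, ← hbdef, ← hexp]
            linear_combination Complex.exp (Complex.I * x * ξ + Complex.I * t * ξ ^ 3 - l * ξ ^ 2) *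
              Complex.exp (-(y : ℂ) ^ 2 / (4 * b)) * Complex.exp (-(z : ℂ) ^ 2 / (4 * b)) * hsq
  · rw [← Measure.volume_eq_prod]
    exact integrable_phase_mul (integrable_exp_neg_mul_dot3 hl).ofReal t _

lemma norm_transverseProfile_le {l t x r σ : ℝ} (hl : 0 < l) (hr : 0 ≤ r)
    (hσ : 6 * |t * σ| ≤ l) (hσ' : l * σ ^ 2 ≤ 1) (ξ : ℝ) :
    ‖transverseProfile l t x r (ξ + σ * Complex.I)‖ ≤
      π * rexp 2 * rexp (-x * σ) * (rexp (-(l / 2) * ξ ^ 2) * (max (l / 2) |t * ξ|)⁻¹) := by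
  have hts := abs_le.1 (show |t * σ| ≤ l / 6 by linarith)
  set b : ℂ := l - Complex.I * t * (ξ + σ * Complex.I) with hb
  have hre : b.re = l + t * σ := by simp [hb]
  have him : b.im = -(t * ξ) := by simp [hb]
  have hb0 : 0 < b.re := by rw [hre]; linarith
  have hbn : max (l / 2) |t * ξ| ≤ ‖b‖ := by
    refine max_le ?_ ?_
    · exact le_trans (by rw [hre]; linarith) (Complex.re_le_norm b)
    · rw [← abs_neg, ← him]; exact Complex.abs_im_le_norm b
  have hmax : 0 < max (l / 2) |t * ξ| := lt_max_of_lt_left (by linarith)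
  have h1 : ‖Complex.exp (-r / (4 * b))‖ ≤ 1 := by
    rw [Complex.norm_exp, Real.exp_le_one_iff]
    have : (-(r : ℂ) / (4 * b)).re = -(r / 4 * (b⁻¹).re) := by
      have : (-(r : ℂ) / (4 * b)) = ((-(r / 4) : ℝ) : ℂ) * b⁻¹ := by
        push_cast; rw [mul_comm, div_mul_eq_div_div]; ring
      rw [this, Complex.re_ofReal_mul]; ring
    rw [this, Complex.inv_re]
    have := div_nonneg hb0.le (Complex.normSq_nonneg b)
    have := mul_nonneg (by positivity : 0 ≤ r / 4) this
    linarith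
  have h2 : ‖(π / b : ℂ)‖ ≤ π * (max (l / 2) |t * ξ|)⁻¹ := by
    rw [norm_div, Complex.norm_real, Real.norm_of_nonneg pi_pos.le, div_eq_mul_inv]
    gcongr
  have h3 : ‖Complex.exp (Complex.I * x * (ξ + σ * Complex.I) +
      Complex.I * t * (ξ + σ * Complex.I) ^ 3 - l * (ξ + σ * Complex.I) ^ 2)‖ ≤
      rexp 2 * rexp (-x * σ) * rexp (-(l / 2) * ξ ^ 2) := by
    rw [Complex.norm_exp, ← Real.exp_add, ← Real.exp_add, Real.exp_le_exp]
    have : (Complex.I * x * (ξ + σ * Complex.I) +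
      Complex.I * t * (ξ + σ * Complex.I) ^ 3 - l * (ξ + σ * Complex.I) ^ 2).re =
      -x * σ + t * σ * σ ^ 2 + l * σ ^ 2 - ξ ^ 2 * (l + 3 * (t * σ)) := by
      simp [pow_succ]; ring
    rw [this]
    nlinarith [sq_nonneg ξ, sq_nonneg σ, mul_nonneg (sq_nonneg ξ) (by linarith : 0 ≤ l / 2 + 3 * (t * σ)),
      mul_nonneg (sq_nonneg σ) (by linarith : 0 ≤ l / 6 - t * σ)]
  rw [transverseProfile, ← hb, norm_mul, norm_mul]
  calc _ ≤ rexp 2 * rexp (-x * σ) * rexp (-(l / 2) * ξ ^ 2) *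
        (π * (max (l / 2) |t * ξ|)⁻¹ * 1) := by gcongr
    _ = _ := by ring

lemma norm_gaussKernel_le_integral {l t x y z σ : ℝ} (hl : 0 < l)
    (hσ : 6 * |t * σ| ≤ l) (hσ' : l * σ ^ 2 ≤ 1) :
    ‖gaussKernel l t (x, y, z)‖ ≤ π * rexp 2 * rexp (-x * σ) *
      ∫ ξ : ℝ, rexp (-(l / 2) * ξ ^ 2) * (max (l / 2) |t * ξ|)⁻¹ := by
  have hr : 0 ≤ y ^ 2 + z ^ 2 := by positivity
  have hmax : ∀ ξ : ℝ, (max (l / 2) |t * ξ|)⁻¹ ≤ (l / 2)⁻¹ := fun ξ => by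
    gcongr; exact le_max_left _ _
  have hle : ∀ u ∈ Set.uIcc 0 σ, |u| ≤ |σ| := fun u hu => by
    simpa using Set.abs_sub_left_of_mem_uIcc hu
  have h6 : ∀ u ∈ Set.uIcc 0 σ, 6 * |t * u| ≤ l := fun u hu => by
    refine le_trans ?_ hσ
    rw [abs_mul, abs_mul]
    have := hle u hu
    gcongr
  have hq : ∀ u ∈ Set.uIcc 0 σ, l * u ^ 2 ≤ 1 := fun u hu => by
    refine le_trans ?_ hσ'
    have := sq_le_sq.2 (hle u hu)
    gcongr
  rw [gaussKernel_eq_integral_transverseProfile hl, ← integral_add_mul_I_eq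
    (σ := σ) (c := l / 2) (C := π * rexp 2 * rexp (|x| * |σ|) * (l / 2)⁻¹) (by positivity)]
  · rw [← integral_const_mul]
    refine norm_integral_le_of_norm_le ?_
      (Eventually.of_forall fun ξ => norm_transverseProfile_le hl hr hσ hσ' ξ)
    refine Integrable.const_mul ?_ _
    refine ((integrable_exp_neg_mul_sq (half_pos hl)).mul_const (l / 2)⁻¹).mono' ?_ ?_
    · exact (by fun_prop : Measurable _).aestronglyMeasurable
    · refine Eventually.of_forall fun ξ => ?_
      rw [Real.norm_of_nonneg (by positivity)]
      gcongr
      exact le_max_left _ _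
  · intro u v hv
    have hts := abs_le.1 (h6 v hv |>.trans' (by linarith [abs_nonneg (t * v)] : |t * v| ≤ _))
    have hts' := abs_le.1 (show |t * v| ≤ l / 6 by linarith [h6 v hv])
    have hb : (l - Complex.I * t * (u + v * Complex.I) : ℂ) ≠ 0 := by
      intro h
      have := congrArg Complex.re h
      simp at this
      linarith
    unfold transverseProfile
    have hb4 : (4 * (l - Complex.I * t * (u + v * Complex.I)) : ℂ) ≠ 0 :=
      mul_ne_zero (by norm_num) hb
    fun_prop (disch := assumption)
  · intro u v hv
    refine (norm_transverseProfile_le hl hr (h6 v hv) (hq v hv) u).trans ?_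
    have hx : -x * v ≤ |x| * |σ| := calc
      -x * v ≤ |(-x) * v| := le_abs_self _
      _ = |x| * |v| := by rw [abs_mul, abs_neg]
      _ ≤ _ := by have := hle v hv; gcongr
    have := hmax u
    calc _ ≤ π * rexp 2 * rexp (|x| * |σ|) * (rexp (-(l / 2) * u ^ 2) * (l / 2)⁻¹) := by gcongr
      _ = _ := by ring

lemma integral_abs_rpow_mul_exp {θ p b : ℝ} (hθ : 0 < θ) (hp : 0 < p) (hb : 0 < b) :
    ∫ x : ℝ, |x| ^ (θ - 1) * rexp (-b * |x| ^ p) =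
      2 * (b ^ (-θ / p) * (1 / p) * Real.Gamma (θ / p)) := by
  rw [integral_comp_abs (f := fun x => x ^ (θ - 1) * rexp (-b * x ^ p)),
    integral_rpow_mul_exp_neg_mul_rpow hp (by linarith) hb]
  simp

lemma integrable_abs_rpow_mul_exp {θ p b : ℝ} (hθ : 0 < θ) (hp : 0 < p) (hb : 0 < b) :
    Integrable fun x : ℝ => |x| ^ (θ - 1) * rexp (-b * |x| ^ p) := by
  refine Integrable.of_integral_ne_zero ?_
  rw [integral_abs_rpow_mul_exp hθ hp hb]
  have := Real.Gamma_pos_of_pos (div_pos hθ hp)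
  positivity

lemma integral_exp_mul_inv_max_le {l : ℝ} (hl : 0 < l) (t : ℝ) :
    ∫ ξ : ℝ, rexp (-(l / 2) * ξ ^ 2) * (max (l / 2) |t * ξ|)⁻¹ ≤
      √(π / (l / 2)) * (l / 2)⁻¹ := by
  rw [← integral_gaussian, ← integral_mul_const]
  refine integral_mono_of_nonneg (Eventually.of_forall fun ξ => by positivity)
    ((integrable_exp_neg_mul_sq (half_pos hl)).mul_const _) (Eventually.of_forall fun ξ => ?_)
  dsimp only
  gcongr
  exact le_max_left _ _

lemma integral_exp_mul_inv_max_le_rpow {l θ t : ℝ} (hl : 0 < l) (hθ : 0 < θ) (hθ' : θ < 1)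
    (ht : t ≠ 0) :
    ∫ ξ : ℝ, rexp (-(l / 2) * ξ ^ 2) * (max (l / 2) |t * ξ|)⁻¹ ≤
      Real.Gamma (θ / 2) * (l / 2) ^ (-(3 * θ / 2)) * |t| ^ (θ - 1) := by
  have hl2 := half_pos hl
  have key := integral_abs_rpow_mul_exp hθ two_pos hl2
  calc _ ≤ ∫ ξ : ℝ, (l / 2) ^ (-θ) * |t| ^ (θ - 1) *
        (|ξ| ^ (θ - 1) * rexp (-(l / 2) * |ξ| ^ (2 : ℝ))) := by
        refine integral_mono_of_nonneg (Eventually.of_forall fun ξ => by positivity)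
          ((integrable_abs_rpow_mul_exp hθ two_pos hl2).const_mul _) ?_
        filter_upwards [compl_mem_ae_iff.2 (measure_singleton (0 : ℝ))] with ξ hξ
        have hξ0 : ξ ≠ 0 := hξ
        have htξ : 0 < |t * ξ| := abs_pos.2 (mul_ne_zero ht hξ0)
        have hm : 0 < max (l / 2) |t * ξ| := lt_max_of_lt_left hl2
        have h1 : (max (l / 2) |t * ξ|)⁻¹ ≤ (l / 2) ^ (-θ) * (|t| ^ (θ - 1) * |ξ| ^ (θ - 1)) := by
          rw [← Real.mul_rpow (abs_nonneg _) (abs_nonneg _), ← abs_mul]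
          calc (max (l / 2) |t * ξ|)⁻¹ = (max (l / 2) |t * ξ|) ^ (-θ) *
                (max (l / 2) |t * ξ|) ^ (θ - 1) := by
                rw [← Real.rpow_add hm, ← Real.rpow_neg_one]; congr 1; ring
            _ ≤ _ := mul_le_mul
                (Real.rpow_le_rpow_of_nonpos hl2 (le_max_left _ _) (by linarith))
                (Real.rpow_le_rpow_of_nonpos htξ (le_max_right _ _) (by linarith))
                (by positivity) (by positivity)
        rw [Real.rpow_two, sq_abs]
        calc _ ≤ rexp (-(l / 2) * ξ ^ 2) * ((l / 2) ^ (-θ) * (|t| ^ (θ - 1) * |ξ| ^ (θ - 1))) := by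
              gcongr
          _ = _ := by ring
    _ = _ := by
        rw [integral_const_mul, key]
        have : (l / 2) ^ (-(3 * θ / 2)) = (l / 2) ^ (-θ) * (l / 2) ^ (-θ / 2) := by
          rw [← Real.rpow_add hl2]; congr 1; ring
        rw [this]
        ring

lemma rpow_mul_exp_neg_le {θ u : ℝ} (hθ : 0 < θ) (hθ' : θ < 1) (hu : 0 < u) :
    u ^ (1 - θ) * rexp (-(u / 12)) ≤ 12 := by
  have h1 : u ^ (1 - θ) ≤ 1 + u := by
    rcases le_total u 1 with h | h
    · have := Real.rpow_le_one hu.le h (by linarith : 0 ≤ 1 - θ)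
      linarith
    · have := Real.rpow_le_rpow_of_exponent_le h (by linarith : 1 - θ ≤ 1)
      rw [Real.rpow_one] at this
      linarith
  have h2 := Real.add_one_le_exp (u / 12)
  rw [Real.exp_neg, ← div_eq_mul_inv, div_le_iff₀ (Real.exp_pos _)]
  linarith

lemma exists_sign_mul_eq_abs (x : ℝ) : ∃ ε : ℝ, |ε| = 1 ∧ ε ^ 2 = 1 ∧ ε * x = |x| := by
  rcases le_total 0 x with h | h
  · exact ⟨1, by simp, by simp, by simp [abs_of_nonneg h]⟩
  · exact ⟨-1, by simp, by simp, by simp [abs_of_nonpos h]⟩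

lemma norm_gaussKernel_le_of_small {l t x y z : ℝ} (hl : 0 < l) (ht : |t| ≤ √l ^ 3) :
    ‖gaussKernel l t (x, y, z)‖ ≤
      π * rexp 2 * (√(π / (l / 2)) * (l / 2)⁻¹) * rexp (-(6 * √l)⁻¹ * |x|) := by
  obtain ⟨ε, hε, hε2, hεx⟩ := exists_sign_mul_eq_abs x
  have hm : 0 < √l := Real.sqrt_pos.2 hl
  have hm2 : √l ^ 2 = l := Real.sq_sqrt hl.le
  have h := norm_gaussKernel_le_integral (t := t) (x := x) (y := y) (z := z)
    (σ := ε * (6 * √l)⁻¹) hl ?_ ?_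
  · refine h.trans ?_
    have : -x * (ε * (6 * √l)⁻¹) = -(6 * √l)⁻¹ * |x| := by rw [← hεx]; ring
    rw [this]
    have := integral_exp_mul_inv_max_le hl t
    calc _ ≤ π * rexp 2 * rexp (-(6 * √l)⁻¹ * |x|) * (√(π / (l / 2)) * (l / 2)⁻¹) := by gcongr
      _ = _ := by ring
  · rw [abs_mul, abs_mul, hε, one_mul, abs_of_pos (by positivity : 0 < (6 * √l)⁻¹)]
    calc 6 * (|t| * (6 * √l)⁻¹) ≤ 6 * (√l ^ 3 * (6 * √l)⁻¹) := by gcongr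
      _ = √l ^ 2 := by field_simp
      _ = l := hm2
      _ ≤ l := le_rfl
  · rw [mul_pow, hε2, one_mul, inv_pow, mul_pow, hm2]
    rw [← div_eq_mul_inv, div_le_one (by positivity)]
    linarith

lemma norm_gaussKernel_le_of_large {l t x y z θ : ℝ} (hl : 0 < l) (hθ : 0 < θ) (hθ' : θ < 1)
    (ht : √l ^ 3 ≤ |t|) (ht1 : |t| ≤ 1) (hx : x ≠ 0) :
    ‖gaussKernel l t (x, y, z)‖ ≤
      π * rexp 2 * (Real.Gamma (θ / 2) * (l / 2) ^ (-(3 * θ / 2))) * 12 * l ^ (θ - 1) *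
        (|x| ^ (θ - 1) * rexp (-(l / 12) * |x|)) := by
  obtain ⟨ε, hε, hε2, hεx⟩ := exists_sign_mul_eq_abs x
  have hm : 0 < √l := Real.sqrt_pos.2 hl
  have hm2 : √l ^ 2 = l := Real.sq_sqrt hl.le
  have htp : 0 < |t| := lt_of_lt_of_le (by positivity) ht
  have hx' : 0 < |x| := abs_pos.2 hx
  have hΓ := Real.Gamma_pos_of_pos (half_pos hθ)
  have h := norm_gaussKernel_le_integral (t := t) (x := x) (y := y) (z := z)
    (σ := ε * (l / (6 * |t|))) hl ?_ ?_
  · refine h.trans ?_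
    set u := l * |x| / |t| with hu
    have hup : 0 < u := by positivity
    have e1 : rexp (-x * (ε * (l / (6 * |t|)))) = rexp (-(u / 12)) * rexp (-(u / 12)) := by
      rw [← Real.exp_add]
      congr 1
      rw [hu, ← hεx]
      field_simp
      ring
    have e2 : rexp (-(u / 12)) ≤ rexp (-(l / 12) * |x|) := by
      rw [Real.exp_le_exp]
      have : l * |x| ≤ u := by rw [hu, le_div_iff₀ htp]; exact mul_le_of_le_one_right (by positivity) ht1
      linarith
    have e3 : |t| ^ (θ - 1) = l ^ (θ - 1) * |x| ^ (θ - 1) * u ^ (1 - θ) := by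
      rw [← Real.mul_rpow hl.le hx'.le, ← neg_sub θ 1, Real.rpow_neg hup.le, ← div_eq_mul_inv,
        ← Real.div_rpow (by positivity) hup.le]
      congr 1
      rw [hu]
      field_simp
    have e4 := rpow_mul_exp_neg_le hθ hθ' hup
    have e5 := integral_exp_mul_inv_max_le_rpow hl hθ hθ' (abs_pos.1 htp)
    rw [e3] at e5
    rw [e1]
    calc _ ≤ π * rexp 2 * (rexp (-(u / 12)) * rexp (-(u / 12))) *
          (Real.Gamma (θ / 2) * (l / 2) ^ (-(3 * θ / 2)) *
            (l ^ (θ - 1) * |x| ^ (θ - 1) * u ^ (1 - θ))) := by gcongr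
      _ = π * rexp 2 * (Real.Gamma (θ / 2) * (l / 2) ^ (-(3 * θ / 2))) *
          (u ^ (1 - θ) * rexp (-(u / 12))) * l ^ (θ - 1) *
          (|x| ^ (θ - 1) * rexp (-(u / 12))) := by ring
      _ ≤ _ := by gcongr
  · rw [abs_mul, abs_mul, hε, one_mul, abs_of_pos (by positivity : 0 < l / (6 * |t|))]
    refine le_of_eq ?_
    field_simp
  · rw [mul_pow, hε2, one_mul, div_pow, mul_pow, mul_div_assoc']
    rw [div_le_one (by positivity)]
    calc l * l ^ 2 = (√l ^ 3) ^ 2 := by rw [← pow_mul, mul_comm 3 2, pow_mul, hm2]; ring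
      _ ≤ |t| ^ 2 := by gcongr
      _ ≤ _ := by nlinarith [sq_nonneg |t|]

lemma exists_gaussKernel_majorant {θ : ℝ} (hθ : 0 < θ) (hθ' : θ < 1) :
    ∃ C : ℝ, 0 < C ∧ ∀ l : ℝ, 0 < l → ∃ h : ℝ → ℝ, Integrable h ∧ (∀ x, 0 ≤ h x) ∧
      (∫ x, h x ≤ C * (l ^ (-1 : ℝ) + l ^ (-1 - 3 * θ / 2))) ∧
      ∀ t x y z : ℝ, |t| ≤ 1 → x ≠ 0 → ‖gaussKernel l t (x, y, z)‖ ≤ h x := by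
  have hΓ := Real.Gamma_pos_of_pos (half_pos hθ)
  have hΓ' := Real.Gamma_pos_of_pos hθ
  set A : ℝ := π * rexp 2 * (√(π * 2) * 2) * 12 with hA
  set B : ℝ := π * rexp 2 * Real.Gamma (θ / 2) * (1 / 2) ^ (-(3 * θ / 2)) * 12 *
    (2 * ((1 / 12) ^ (-θ) * Real.Gamma θ)) with hB
  have hA0 : 0 < A := by positivity
  have hB0 : 0 < B := by positivity
  refine ⟨A + B, by positivity, fun l hl => ?_⟩
  have hm : 0 < √l := Real.sqrt_pos.2 hl
  have hm2 : √l ^ 2 = l := Real.sq_sqrt hl.le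
  have i1 : Integrable fun x : ℝ => rexp (-(6 * √l)⁻¹ * |x|) := by
    simpa using integrable_abs_rpow_mul_exp one_pos one_pos (by positivity : 0 < (6 * √l)⁻¹)
  have j1 : ∫ x : ℝ, rexp (-(6 * √l)⁻¹ * |x|) = 12 * √l := by
    have := integral_abs_rpow_mul_exp one_pos one_pos (by positivity : 0 < (6 * √l)⁻¹)
    simp [Real.rpow_neg_one] at this
    simp [this]
    ring
  have i2 : Integrable fun x : ℝ => |x| ^ (θ - 1) * rexp (-(l / 12) * |x|) := by
    simpa using integrable_abs_rpow_mul_exp hθ one_pos (by positivity : 0 < l / 12)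
  have j2 : ∫ x : ℝ, |x| ^ (θ - 1) * rexp (-(l / 12) * |x|) =
      2 * ((l / 12) ^ (-θ) * Real.Gamma θ) := by
    simpa using integral_abs_rpow_mul_exp hθ one_pos (by positivity : 0 < l / 12)
  refine ⟨fun x => π * rexp 2 * (√(π / (l / 2)) * (l / 2)⁻¹) * rexp (-(6 * √l)⁻¹ * |x|) +
    π * rexp 2 * (Real.Gamma (θ / 2) * (l / 2) ^ (-(3 * θ / 2))) * 12 * l ^ (θ - 1) *
        (|x| ^ (θ - 1) * rexp (-(l / 12) * |x|)), (i1.const_mul _).add (i2.const_mul _),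
    fun x => by positivity, ?_, fun t x y z ht hx => ?_⟩
  · rw [integral_add (i1.const_mul _) (i2.const_mul _), integral_const_mul, integral_const_mul,
      j1, j2]
    have e1 : π * rexp 2 * (√(π / (l / 2)) * (l / 2)⁻¹) * (12 * √l) = A * l ^ (-1 : ℝ) := by
      have : √(π / (l / 2)) = √(π * 2) / √l := by
        rw [← Real.sqrt_div (by positivity)]; congr 1; field_simp
      rw [this, hA, Real.rpow_neg_one]
      field_simp
    have e2 : π * rexp 2 * (Real.Gamma (θ / 2) * (l / 2) ^ (-(3 * θ / 2))) * 12 * l ^ (θ - 1) *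
        (2 * ((l / 12) ^ (-θ) * Real.Gamma θ)) = B * l ^ (-1 - 3 * θ / 2) := by
      have h1 : l ^ (-1 - 3 * θ / 2) = l ^ (-(3 * θ / 2)) * l ^ (θ - 1) * l ^ (-θ) := by
        rw [← Real.rpow_add hl, ← Real.rpow_add hl]; congr 1; ring
      have h2 : (l / 2) ^ (-(3 * θ / 2)) = l ^ (-(3 * θ / 2)) * (1 / 2) ^ (-(3 * θ / 2)) := by
        rw [← Real.mul_rpow hl.le (by norm_num)]; congr 1; ring
      have h3 : (l / 12) ^ (-θ) = l ^ (-θ) * (1 / 12) ^ (-θ) := by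
        rw [← Real.mul_rpow hl.le (by norm_num)]; congr 1; ring
      rw [h1, h2, h3, hB]
      ring
    rw [e1, e2]
    have p1 : 0 < l ^ (-1 : ℝ) := by positivity
    have p2 : 0 < l ^ (-1 - 3 * θ / 2) := by positivity
    nlinarith [mul_pos hA0 p2, mul_pos hB0 p1]
  · rcases le_total |t| (√l ^ 3) with h | h
    · refine (norm_gaussKernel_le_of_small hl h).trans (le_add_of_nonneg_right (by positivity))
    · exact (norm_gaussKernel_le_of_large hl hθ hθ' h ht hx).trans
        (le_add_of_nonneg_left (by positivity))

lemma norm_integral_mul_le {X : Type*} {e : ℝ → X → ℂ} (he1 : ∀ x ξ, ‖e x ξ‖ ≤ 1)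
    {g : ℝ → ℂ} (hgi : Integrable g) (ξ : X) : ‖∫ x, e x ξ * g x‖ ≤ ∫ x, ‖g x‖ := by
  refine norm_integral_le_of_norm_le hgi.norm (Eventually.of_forall fun x => ?_)
  rw [norm_mul]
  exact mul_le_of_le_one_left (norm_nonneg _) (he1 x ξ)

section Duality

variable {X : Type*} [MeasurableSpace X] {μ : Measure X} [SFinite μ]

lemma measurable_integral_mul {e : ℝ → X → ℂ} (he : Measurable (Function.uncurry e))
    {g : ℝ → ℂ} (hg : Measurable g) : Measurable fun ξ => ∫ x, e x ξ * g x := by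
  have : StronglyMeasurable fun q : X × ℝ => e q.2 q.1 * g q.2 := by
    refine Measurable.stronglyMeasurable ?_
    exact (he.comp measurable_swap).mul (hg.comp measurable_snd)
  exact this.integral_prod_right'.measurable

lemma lintegral_lintegral_mul_convolution_le {g : ℝ → ℂ} (hg : Measurable g) {h : ℝ → ENNReal}
    (hh : AEMeasurable h) :
    ∫⁻ x, ∫⁻ x', ‖g x‖ₑ * ‖g x'‖ₑ * h (x - x') ≤ (∫⁻ x, h x) * ∫⁻ x, ‖g x‖ₑ ^ 2 := by
  have hsub : AEMeasurable fun q : ℝ × ℝ => h (q.1 - q.2) :=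
    hh.comp_quasiMeasurePreserving (quasiMeasurePreserving_sub volume volume)
  have hgm : Measurable fun x => ‖g x‖ₑ ^ 2 := hg.enorm.pow_const 2
  have h1 : ∫⁻ x, ∫⁻ x', ‖g x‖ₑ ^ 2 * h (x - x') = (∫⁻ x, h x) * ∫⁻ x, ‖g x‖ₑ ^ 2 := by
    rw [mul_comm, ← lintegral_mul_const _ hgm]
    congr 1
    ext x
    rw [lintegral_const_mul' _ _ (by simp), lintegral_sub_left_eq_self]
  have h2 : ∫⁻ x, ∫⁻ x', ‖g x'‖ₑ ^ 2 * h (x - x') = (∫⁻ x, h x) * ∫⁻ x, ‖g x‖ₑ ^ 2 := by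
    rw [lintegral_lintegral_swap, mul_comm, ← lintegral_mul_const _ hgm]
    · congr 1
      ext x
      rw [lintegral_const_mul' _ _ (by simp), lintegral_sub_right_eq_self]
    · exact (hgm.comp measurable_snd).aemeasurable.mul hsub
  have hpt : ∀ x x', 2 * (‖g x‖ₑ * ‖g x'‖ₑ * h (x - x')) ≤
      ‖g x‖ₑ ^ 2 * h (x - x') + ‖g x'‖ₑ ^ 2 * h (x - x') := fun x x' => by
    rw [← add_mul, ← mul_assoc, ← mul_assoc]
    gcongr
    simp only [← ofReal_norm]
    rw [← ENNReal.ofReal_ofNat 2, ← ENNReal.ofReal_mul (by norm_num),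
      ← ENNReal.ofReal_mul (by positivity), ← ENNReal.ofReal_pow (norm_nonneg _),
      ← ENNReal.ofReal_pow (norm_nonneg _), ← ENNReal.ofReal_add (by positivity) (by positivity)]
    exact ENNReal.ofReal_le_ofReal (two_mul_le_add_sq _ _)
  have h3 : 2 * ∫⁻ x, ∫⁻ x', ‖g x‖ₑ * ‖g x'‖ₑ * h (x - x') ≤
      2 * ((∫⁻ x, h x) * ∫⁻ x, ‖g x‖ₑ ^ 2) := by
    have hm1 : AEMeasurable fun q : ℝ × ℝ => ‖g q.1‖ₑ ^ 2 * h (q.1 - q.2) :=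
      (hgm.comp measurable_fst).aemeasurable.mul hsub
    have hm1' : ∀ x, AEMeasurable fun x' => ‖g x‖ₑ ^ 2 * h (x - x') := fun x =>
      (hh.comp_quasiMeasurePreserving (quasiMeasurePreserving_sub_left volume x)).const_mul _
    rw [two_mul (_ * _), ← lintegral_const_mul' _ _ ENNReal.ofNat_ne_top]
    nth_rewrite 1 [← h1]
    rw [← h2, ← lintegral_add_left' hm1.lintegral_prod_right']
    refine lintegral_mono fun x => ?_
    dsimp only
    rw [← lintegral_const_mul' _ _ ENNReal.ofNat_ne_top, ← lintegral_add_left' (hm1' x)]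
    exact lintegral_mono fun x' => hpt x x'
  exact (ENNReal.mul_le_mul_iff_right two_ne_zero ENNReal.ofNat_ne_top).1 h3

/-- `T T*` bound: a convolution majorant for the kernel controls the dual operator. -/
lemma lintegral_weight_mul_sq_le {e : ℝ → X → ℂ} (he : Measurable (Function.uncurry e))
    (he1 : ∀ x ξ, ‖e x ξ‖ ≤ 1) {W : X → ℝ} (hW : Integrable W μ) (hW0 : ∀ ξ, 0 ≤ W ξ)
    {h : ℝ → ℝ} (hh : Integrable h) (hh0 : ∀ x, 0 ≤ h x)
    (hk : ∀ x x', x ≠ x' → ‖∫ ξ, e x ξ * starRingEnd ℂ (e x' ξ) * W ξ ∂μ‖ ≤ h (x - x'))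
    {g : ℝ → ℂ} (hg : Measurable g) (hgi : Integrable g) :
    ∫⁻ ξ, ENNReal.ofReal (W ξ) * ‖∫ x, e x ξ * g x‖ₑ ^ 2 ∂μ ≤
      ENNReal.ofReal (∫ x, h x) * ∫⁻ x, ‖g x‖ₑ ^ 2 := by
  set G : X → ℂ := fun ξ => ∫ x, e x ξ * g x with hG
  have hGm : Measurable G := measurable_integral_mul he hg
  have hGb : ∀ ξ, ‖G ξ‖ ≤ ∫ x, ‖g x‖ := norm_integral_mul_le he1 hgi
  set Φ : X × (ℝ × ℝ) → ℂ := fun q =>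
    (W q.1 : ℂ) * ((e q.2.1 q.1 * g q.2.1) * starRingEnd ℂ (e q.2.2 q.1 * g q.2.2)) with hΦ
  have hem : ∀ {f : X × (ℝ × ℝ) → ℝ}, Measurable f → Measurable fun q => e (f q) q.1 :=
    fun hf => he.comp (hf.prodMk measurable_fst)
  have hΦi : Integrable Φ (μ.prod volume) := by
    have hdom : Integrable (fun q : X × (ℝ × ℝ) => W q.1 * (‖g q.2.1‖ * ‖g q.2.2‖))
        (μ.prod volume) := hW.mul_prod (hgi.norm.mul_prod hgi.norm)
    refine hdom.mono' ?_ (Eventually.of_forall fun q => ?_)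
    · refine (hW.ofReal (𝕜 := ℂ)).aestronglyMeasurable.comp_fst.mul ?_
      have m1 := hem (f := fun q => q.2.1) (by fun_prop)
      have m2 := hem (f := fun q => q.2.2) (by fun_prop)
      refine Measurable.aestronglyMeasurable ?_
      exact (m1.mul (hg.comp (by fun_prop))).mul
        (Complex.continuous_conj.measurable.comp (m2.mul (hg.comp (by fun_prop))))
    · simp only [hΦ, norm_mul, RCLike.norm_conj, Complex.norm_real, Real.norm_of_nonneg (hW0 q.1)]
      have := he1 q.2.1 q.1
      have := he1 q.2.2 q.1
      have := hW0 q.1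
      calc _ ≤ W q.1 * (1 * ‖g q.2.1‖ * (1 * ‖g q.2.2‖)) := by gcongr
        _ = _ := by ring
  have hinner : ∀ ξ, ∫ w : ℝ × ℝ, Φ (ξ, w) = ((W ξ * ‖G ξ‖ ^ 2 : ℝ) : ℂ) := fun ξ => by
    simp only [hΦ]
    rw [integral_const_mul, Measure.volume_eq_prod, integral_prod_mul
      (fun x => e x ξ * g x) (fun x => starRingEnd ℂ (e x ξ * g x)), integral_conj]
    push_cast
    rw [← Complex.mul_conj']
  have hkm : ∀ w : ℝ × ℝ, ∫ ξ, Φ (ξ, w) ∂μ = g w.1 * starRingEnd ℂ (g w.2) *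
      ∫ ξ, e w.1 ξ * starRingEnd ℂ (e w.2 ξ) * W ξ ∂μ := fun w => by
    rw [← integral_const_mul]
    congr 1
    ext ξ
    simp only [hΦ, map_mul]
    ring
  have hWG : Integrable (fun ξ => W ξ * ‖G ξ‖ ^ 2) μ := by
    refine hW.mul_bdd (c := (∫ x, ‖g x‖) ^ 2) (hGm.norm.pow_const 2).aestronglyMeasurable
      (Eventually.of_forall fun ξ => ?_)
    rw [norm_pow, norm_norm]
    have := hGb ξ
    gcongr
  have hdiag : ∀ x : ℝ, ∀ᵐ x' : ℝ, x ≠ x' := fun x => by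
    filter_upwards [compl_mem_ae_iff.2 (measure_singleton x)] with x' hx'
    exact fun h => hx' h.symm
  calc ∫⁻ ξ, ENNReal.ofReal (W ξ) * ‖G ξ‖ₑ ^ 2 ∂μ
      = ENNReal.ofReal (∫ ξ, W ξ * ‖G ξ‖ ^ 2 ∂μ) := by
        rw [ofReal_integral_eq_lintegral_ofReal hWG
          (Eventually.of_forall fun ξ => mul_nonneg (hW0 ξ) (by positivity))]
        congr 1
        ext ξ
        rw [ENNReal.ofReal_mul (hW0 ξ), ENNReal.ofReal_pow (norm_nonneg _), ofReal_norm]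
    _ = ‖∫ ξ, (∫ w : ℝ × ℝ, Φ (ξ, w)) ∂μ‖ₑ := by
        simp_rw [hinner]
        rw [integral_complex_ofReal, ← ofReal_norm, Complex.norm_real, Real.norm_of_nonneg]
        exact integral_nonneg fun ξ => mul_nonneg (hW0 ξ) (by positivity)
    _ = ‖∫ w : ℝ × ℝ, ∫ ξ, Φ (ξ, w) ∂μ‖ₑ := by
        rw [integral_integral_swap (f := fun ξ w => Φ (ξ, w)) hΦi]
    _ ≤ ∫⁻ w : ℝ × ℝ, ‖∫ ξ, Φ (ξ, w) ∂μ‖ₑ := enorm_integral_le_lintegral_enorm _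
    _ ≤ ∫⁻ x, ∫⁻ x', ‖∫ ξ, Φ (ξ, (x, x')) ∂μ‖ₑ := by
        rw [Measure.volume_eq_prod]
        exact lintegral_prod_le _
    _ ≤ ∫⁻ x, ∫⁻ x', ‖g x‖ₑ * ‖g x'‖ₑ * ENNReal.ofReal (h (x - x')) := by
        refine lintegral_mono fun x => lintegral_mono_ae ?_
        filter_upwards [hdiag x] with x' hx'
        rw [hkm, enorm_mul, enorm_mul, RCLike.enorm_conj]
        gcongr
        rw [← ofReal_norm]
        exact ENNReal.ofReal_le_ofReal (hk x x' hx')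
    _ ≤ (∫⁻ x, ENNReal.ofReal (h x)) * ∫⁻ x, ‖g x‖ₑ ^ 2 :=
        lintegral_lintegral_mul_convolution_le hg hh.aestronglyMeasurable.aemeasurable.ennreal_ofReal
    _ = _ := by rw [ofReal_integral_eq_lintegral_ofReal hh (Eventually.of_forall hh0)]

lemma lintegral_sq_le_of_dual_bound {e : ℝ → X → ℂ} (he : Measurable (Function.uncurry e))
    (he1 : ∀ x ξ, ‖e x ξ‖ ≤ 1) {a : X → ℂ} (ha : Integrable a μ) {w : X → ENNReal}
    (hw : AEMeasurable w μ) (hw0 : ∀ ξ, w ξ ≠ 0) (hwt : ∀ ξ, w ξ ≠ ⊤) {M : ENNReal}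
    (hM : ∀ g : ℝ → ℂ, Measurable g → Integrable g →
      ∫⁻ ξ, w ξ * ‖∫ x, e x ξ * g x‖ₑ ^ 2 ∂μ ≤ M * ∫⁻ x, ‖g x‖ₑ ^ 2) :
    ∫⁻ x, ‖∫ ξ, e x ξ * a ξ ∂μ‖ₑ ^ 2 ≤ M * ∫⁻ ξ, (w ξ)⁻¹ * ‖a ξ‖ₑ ^ 2 ∂μ := by
  obtain ⟨a', ha'm, haa'⟩ := ha.aestronglyMeasurable
  set u : ℝ → ℂ := fun x => ∫ ξ, e x ξ * a ξ ∂μ with hu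
  have hum : Measurable u := by
    have h1 : u = fun x => ∫ ξ, e x ξ * a' ξ ∂μ := by
      ext x
      refine integral_congr_ae ?_
      filter_upwards [haa'] with ξ hξ
      rw [hξ]
    rw [h1]
    have : StronglyMeasurable fun q : ℝ × X => e q.1 q.2 * a' q.2 :=
      (he.mul (ha'm.measurable.comp measurable_snd)).stronglyMeasurable
    exact this.integral_prod_right'.measurable
  have hub : ∀ x, ‖u x‖ ≤ ∫ ξ, ‖a ξ‖ ∂μ := fun x => by
    refine norm_integral_le_of_norm_le ha.norm (Eventually.of_forall fun ξ => ?_)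
    rw [norm_mul]
    exact mul_le_of_le_one_left (norm_nonneg _) (he1 x ξ)
  set Q := ∫⁻ ξ, (w ξ)⁻¹ * ‖a ξ‖ₑ ^ 2 ∂μ with hQ
  have hloc : ∀ n : ℕ, ∫⁻ x in Set.Icc (-n : ℝ) n, ‖u x‖ₑ ^ 2 ≤ M * Q := by
    intro n
    set S := Set.Icc (-n : ℝ) n
    have hS : MeasurableSet S := measurableSet_Icc
    set g : ℝ → ℂ := S.indicator fun x => starRingEnd ℂ (u x) with hgdef
    have hgm : Measurable g := (Complex.continuous_conj.measurable.comp hum).indicator hS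
    have hgi : Integrable g := by
      rw [hgdef, integrable_indicator_iff hS]
      refine Measure.integrableOn_of_bounded (M := ∫ ξ, ‖a ξ‖ ∂μ) (by simp [S])
        (Complex.continuous_conj.measurable.comp hum).aestronglyMeasurable
        (Eventually.of_forall fun x => ?_)
      rw [RCLike.norm_conj]
      exact hub x
    set A := ∫⁻ x in S, ‖u x‖ₑ ^ 2 with hA
    have hgA : ∫⁻ x, ‖g x‖ₑ ^ 2 = A := by
      rw [hA, ← lintegral_indicator hS]
      congr 1
      ext x
      by_cases hx : x ∈ S <;> simp [hgdef, hx]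
    have hAtop : A ≠ ⊤ := by
      refine (lt_of_le_of_lt (b := ∫⁻ x in S, ENNReal.ofReal (∫ ξ, ‖a ξ‖ ∂μ) ^ 2) ?_ ?_).ne
      · refine lintegral_mono fun x => ?_
        dsimp only
        rw [← ofReal_norm]
        gcongr
        exact hub x
      · rw [setLIntegral_const]
        refine ENNReal.mul_lt_top (by simp) (by simp [S])
    have hug : ∫ x, u x * g x = ∫ ξ, a ξ * (∫ x, e x ξ * g x) ∂μ := by
      calc ∫ x, u x * g x = ∫ x, ∫ ξ, e x ξ * a ξ * g x ∂μ := by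
            simp_rw [hu, integral_mul_const]
        _ = ∫ ξ, (∫ x, e x ξ * a ξ * g x) ∂μ := by
            refine integral_integral_swap (f := fun x ξ => e x ξ * a ξ * g x) ?_
            have hdom := hgi.mul_prod ha
            refine hdom.norm.mono' ?_ (Eventually.of_forall fun q => ?_)
            · exact (he.aestronglyMeasurable.mul ha.aestronglyMeasurable.comp_snd).mul
                (hgm.comp measurable_fst).aestronglyMeasurable
            · simp only [Function.uncurry, norm_mul]
              have := he1 q.1 q.2
              calc _ ≤ 1 * ‖a q.2‖ * ‖g q.1‖ := by gcongr
                _ = _ := by ring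
        _ = _ := by
            congr 1
            ext ξ
            rw [← integral_const_mul]
            congr 1
            ext x
            ring
    have hAeq : A = ‖∫ x, u x * g x‖ₑ := by
      have h1 : ∀ x, u x * g x = ((S.indicator (fun x => ‖u x‖ ^ 2) x : ℝ) : ℂ) := fun x => by
        by_cases hx : x ∈ S
        · simp [hgdef, hx, Complex.mul_conj']
        · simp [hgdef, hx]
      have h2 : Integrable (S.indicator fun x => ‖u x‖ ^ 2) := by
        have : Integrable fun x => u x * g x :=
          hgi.bdd_mul hum.aestronglyMeasurable (Eventually.of_forall hub)
        simp_rw [h1] at this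
        exact this.re
      simp_rw [h1]
      have h3 : ∀ x, 0 ≤ S.indicator (fun x => ‖u x‖ ^ 2) x :=
        Set.indicator_nonneg fun x _ => by positivity
      rw [integral_complex_ofReal, ← ofReal_norm, Complex.norm_real,
        Real.norm_of_nonneg (integral_nonneg h3),
        ofReal_integral_eq_lintegral_ofReal h2 (Eventually.of_forall h3), hA,
        ← lintegral_indicator hS]
      congr 1
      ext x
      by_cases hx : x ∈ S <;> simp [hx, ENNReal.ofReal_pow]
    have hGm := measurable_integral_mul he hgm
    have hCS : A ≤ Q ^ (1 / 2 : ℝ) * (M * A) ^ (1 / 2 : ℝ) := by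
      calc A ≤ ∫⁻ ξ, ‖a ξ‖ₑ * ‖∫ x, e x ξ * g x‖ₑ ∂μ := by
            rw [hAeq, hug]
            refine (enorm_integral_le_lintegral_enorm _).trans_eq ?_
            simp_rw [enorm_mul]
        _ = ∫⁻ ξ, ((w ξ)⁻¹ * ‖a ξ‖ₑ ^ 2) ^ (1 / 2 : ℝ) *
              (w ξ * ‖∫ x, e x ξ * g x‖ₑ ^ 2) ^ (1 / 2 : ℝ) ∂μ := by
            congr 1
            ext ξ
            rw [← ENNReal.mul_rpow_of_nonneg _ _ (by norm_num)]
            have : (w ξ)⁻¹ * ‖a ξ‖ₑ ^ 2 * (w ξ * ‖∫ x, e x ξ * g x‖ₑ ^ 2) =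
                (‖a ξ‖ₑ * ‖∫ x, e x ξ * g x‖ₑ) ^ (2 : ℝ) := by
              rw [ENNReal.rpow_two, mul_pow]
              calc _ = ((w ξ)⁻¹ * w ξ) * (‖a ξ‖ₑ ^ 2 * ‖∫ x, e x ξ * g x‖ₑ ^ 2) := by ring
                _ = _ := by rw [ENNReal.inv_mul_cancel (hw0 ξ) (hwt ξ), one_mul]
            rw [this, ← ENNReal.rpow_mul]
            norm_num
        _ ≤ Q ^ (1 / 2 : ℝ) * (∫⁻ ξ, w ξ * ‖∫ x, e x ξ * g x‖ₑ ^ 2 ∂μ) ^ (1 / 2 : ℝ) :=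
            ENNReal.lintegral_mul_norm_pow_le
              (hw.inv.mul (ha.aestronglyMeasurable.enorm.pow_const 2))
              (hw.mul (hGm.enorm.pow_const 2).aemeasurable)
              (by norm_num) (by norm_num) (by norm_num)
        _ ≤ _ := by
            gcongr
            rw [← hgA]
            exact hM g hgm hgi
    rcases eq_or_ne A 0 with hA0 | hA0
    · rw [hA0]; exact zero_le
    have h2 : A * A ≤ M * Q * A := by
      have := ENNReal.rpow_le_rpow hCS (by norm_num : (0 : ℝ) ≤ 2)
      rw [← ENNReal.mul_rpow_of_nonneg _ _ (by norm_num), ← ENNReal.rpow_mul] at this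
      norm_num at this
      calc A * A = A ^ 2 := (sq A).symm
        _ ≤ _ := this
        _ = _ := by ring
    exact (ENNReal.mul_le_mul_iff_left hA0 hAtop).1 h2
  have hcov : AECover volume atTop fun n : ℕ => Set.Icc (-n : ℝ) n :=
    aecover_Icc (tendsto_neg_atTop_atBot.comp tendsto_natCast_atTop_atTop)
      tendsto_natCast_atTop_atTop
  exact le_of_tendsto (hcov.lintegral_tendsto_of_countably_generated
    (hum.enorm.pow_const 2).aemeasurable) (Eventually.of_forall hloc)

end Duality

lemma dot3_self_nonneg (ξ : ℝ × ℝ × ℝ) : 0 ≤ dot3 ξ ξ := by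
  unfold dot3; nlinarith [sq_nonneg ξ.1, sq_nonneg ξ.2.1, sq_nonneg ξ.2.2]

lemma continuous_dot3_self : Continuous fun ξ : ℝ × ℝ × ℝ => dot3 ξ ξ :=
  continuous_dot3.comp (continuous_id.prodMk continuous_id)

/-- The pairing for which `VectorFourier.fourierIntegral` has the phase of `FT3`. -/
def dot3CLM : (ℝ × ℝ × ℝ) →L[ℝ] (ℝ × ℝ × ℝ) →L[ℝ] ℝ :=
  let p₁ := ContinuousLinearMap.fst ℝ ℝ (ℝ × ℝ)
  let p₂ := (ContinuousLinearMap.fst ℝ ℝ ℝ).comp (ContinuousLinearMap.snd ℝ ℝ (ℝ × ℝ))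
  let p₃ := (ContinuousLinearMap.snd ℝ ℝ ℝ).comp (ContinuousLinearMap.snd ℝ ℝ (ℝ × ℝ))
  let m := ContinuousLinearMap.mul ℝ ℝ
  (2 * π)⁻¹ • (m.bilinearComp p₁ p₁ + m.bilinearComp p₂ p₂ + m.bilinearComp p₃ p₃)

lemma dot3CLM_apply (x ξ : ℝ × ℝ × ℝ) : dot3CLM x ξ = (2 * π)⁻¹ * dot3 x ξ := by
  simp [dot3CLM, dot3]
  ring

instance : (volume : Measure (ℝ × ℝ × ℝ)).IsAddHaarMeasure :=
  haveI : (volume : Measure (ℝ × ℝ)).IsAddHaarMeasure :=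
    Measure.prod.instIsAddHaarMeasure volume volume
  Measure.prod.instIsAddHaarMeasure volume volume

lemma FT3_eq_fourierIntegral (φ : ℝ × ℝ × ℝ → ℂ) (ξ : ℝ × ℝ × ℝ) :
    FT3 φ ξ = ((((2 * π) ^ 3)⁻¹ : ℝ) : ℂ) *
      VectorFourier.fourierIntegral Real.fourierChar volume dot3CLM.toLinearMap₁₂ φ ξ := by
  unfold FT3 VectorFourier.fourierIntegral
  congr 2
  ext x
  rw [ContinuousLinearMap.toLinearMap₁₂_apply_apply_apply, dot3CLM_apply, Circle.smul_def,
    Real.fourierChar_apply, smul_eq_mul]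
  congr 2
  have : (π : ℂ) ≠ 0 := Complex.ofReal_ne_zero.2 pi_ne_zero
  push_cast
  field_simp

lemma continuous_FT3 (φ : SchwartzMap (ℝ × ℝ × ℝ) ℂ) : Continuous (FT3 φ) := by
  have h : Continuous (VectorFourier.fourierIntegral Real.fourierChar volume
      dot3CLM.toLinearMap₁₂ φ) := by
    refine VectorFourier.fourierIntegral_continuous Real.continuous_fourierChar ?_ φ.integrable
    simp only [ContinuousLinearMap.toLinearMap₁₂_apply_apply_apply, dot3CLM_apply]
    exact continuous_dot3.const_mul _
  rw [funext (FT3_eq_fourierIntegral φ)]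
  exact h.const_mul _

lemma exists_abs_dot3_pow_mul_norm_FT3_le (φ : SchwartzMap (ℝ × ℝ × ℝ) ℂ) (v : ℝ × ℝ × ℝ) (n : ℕ) :
    ∃ C, ∀ ξ, |dot3 v ξ| ^ n * ‖FT3 φ ξ‖ ≤ C := by
  obtain ⟨C, hC⟩ : ∃ C, ∀ ξ, |dot3CLM v ξ| ^ n * ‖VectorFourier.fourierIntegral Real.fourierChar
      volume dot3CLM.toLinearMap₁₂ φ ξ‖ ≤ C := by
    refine ⟨_, fun ξ => by
      simpa only [norm_iteratedFDeriv_zero] using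
        VectorFourier.pow_mul_norm_iteratedFDeriv_fourierIntegral_le dot3CLM (K := 0) (N := n)
          (μ := volume) (f := φ) (φ.smooth _)
          (fun k m _ _ => φ.integrable_pow_mul_iteratedFDeriv volume k m) (k := 0) (n := n)
          le_rfl le_rfl v ξ⟩
  refine ⟨(2 * π) ^ n * ‖((((2 * π) ^ 3)⁻¹ : ℝ) : ℂ)‖ * C, fun ξ => ?_⟩
  have h1 : |dot3 v ξ| = 2 * π * |dot3CLM v ξ| := by
    rw [dot3CLM_apply, abs_mul, abs_of_pos (by positivity : 0 < (2 * π)⁻¹)]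
    field_simp
  rw [h1, FT3_eq_fourierIntegral, norm_mul, mul_pow]
  have := hC ξ
  calc _ = (2 * π) ^ n * ‖((((2 * π) ^ 3)⁻¹ : ℝ) : ℂ)‖ * (|dot3CLM v ξ| ^ n *
        ‖VectorFourier.fourierIntegral Real.fourierChar volume dot3CLM.toLinearMap₁₂ φ ξ‖) := by
        ring
    _ ≤ _ := by gcongr

lemma exists_one_add_dot3_pow_mul_norm_FT3_le (φ : SchwartzMap (ℝ × ℝ × ℝ) ℂ) (n : ℕ) :
    ∃ C, ∀ ξ, (1 + dot3 ξ ξ) ^ n * ‖FT3 φ ξ‖ ≤ C := by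
  obtain ⟨C₀, h₀⟩ := exists_abs_dot3_pow_mul_norm_FT3_le φ 0 0
  obtain ⟨C₁, h₁⟩ := exists_abs_dot3_pow_mul_norm_FT3_le φ (1, 0, 0) (2 * n)
  obtain ⟨C₂, h₂⟩ := exists_abs_dot3_pow_mul_norm_FT3_le φ (0, 1, 0) (2 * n)
  obtain ⟨C₃, h₃⟩ := exists_abs_dot3_pow_mul_norm_FT3_le φ (0, 0, 1) (2 * n)
  refine ⟨4 ^ n * (C₀ + C₁ + C₂ + C₃), fun ξ => ?_⟩
  have hpow : (1 + dot3 ξ ξ) ^ n ≤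
      4 ^ n * (1 + (ξ.1 ^ 2) ^ n + (ξ.2.1 ^ 2) ^ n + (ξ.2.2 ^ 2) ^ n) := by
    have h2 : ∀ a b : ℝ, 0 ≤ a → 0 ≤ b → (a + b) ^ n ≤ 2 ^ n * (a ^ n + b ^ n) :=
      fun a b ha hb => (add_pow_le ha hb n).trans (by gcongr <;> [norm_num; exact Nat.sub_le n 1])
    have e : (1 + dot3 ξ ξ) = (1 + ξ.1 ^ 2) + (ξ.2.1 ^ 2 + ξ.2.2 ^ 2) := by unfold dot3; ring
    have a1 := h2 1 (ξ.1 ^ 2) zero_le_one (sq_nonneg _)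
    have a2 := h2 (ξ.2.1 ^ 2) (ξ.2.2 ^ 2) (sq_nonneg _) (sq_nonneg _)
    rw [one_pow] at a1
    calc (1 + dot3 ξ ξ) ^ n ≤ 2 ^ n * ((1 + ξ.1 ^ 2) ^ n + (ξ.2.1 ^ 2 + ξ.2.2 ^ 2) ^ n) := by
          rw [e]; exact h2 _ _ (by positivity) (by positivity)
      _ ≤ 2 ^ n * (2 ^ n * (1 + (ξ.1 ^ 2) ^ n) + 2 ^ n * ((ξ.2.1 ^ 2) ^ n + (ξ.2.2 ^ 2) ^ n)) := by
          gcongr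
      _ = (2 * 2) ^ n * (1 + (ξ.1 ^ 2) ^ n + (ξ.2.1 ^ 2) ^ n + (ξ.2.2 ^ 2) ^ n) := by
          rw [mul_pow]; ring
      _ = _ := by norm_num
  have b₀ := h₀ ξ
  have b₁ := h₁ ξ
  have b₂ := h₂ ξ
  have b₃ := h₃ ξ
  simp only [dot3, pow_mul, sq_abs, pow_zero, one_mul, zero_mul, add_zero, zero_add] at b₀ b₁ b₂ b₃
  calc _ ≤ 4 ^ n * (1 + (ξ.1 ^ 2) ^ n + (ξ.2.1 ^ 2) ^ n + (ξ.2.2 ^ 2) ^ n) * ‖FT3 φ ξ‖ := by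
        gcongr
    _ = 4 ^ n * (‖FT3 φ ξ‖ + (ξ.1 ^ 2) ^ n * ‖FT3 φ ξ‖ + (ξ.2.1 ^ 2) ^ n * ‖FT3 φ ξ‖ +
        (ξ.2.2 ^ 2) ^ n * ‖FT3 φ ξ‖) := by ring
    _ ≤ _ := by gcongr

lemma integrable_inv_one_add_dot3_pow :
    Integrable fun ξ : ℝ × ℝ × ℝ => ((1 + dot3 ξ ξ) ^ 3)⁻¹ := by
  have h := integrable_inv_one_add_sq
  refine (h.mul_prod (h.mul_prod h)).mono' ?_ (Eventually.of_forall fun ξ => ?_)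
  · exact ((continuous_dot3_self.measurable.const_add 1).pow_const 3).inv.aestronglyMeasurable
  · have h0 := dot3_self_nonneg ξ
    rw [Real.norm_of_nonneg (by positivity), ← mul_inv, ← mul_inv]
    gcongr
    calc (1 + ξ.1 ^ 2) * ((1 + ξ.2.1 ^ 2) * (1 + ξ.2.2 ^ 2)) ≤
        (1 + dot3 ξ ξ) * ((1 + dot3 ξ ξ) * (1 + dot3 ξ ξ)) := by
          have e : dot3 ξ ξ = ξ.1 ^ 2 + ξ.2.1 ^ 2 + ξ.2.2 ^ 2 := by unfold dot3; ring
          rw [e]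
          gcongr <;> nlinarith [sq_nonneg ξ.1, sq_nonneg ξ.2.1, sq_nonneg ξ.2.2]
      _ = _ := by ring

lemma integrable_FT3 (φ : SchwartzMap (ℝ × ℝ × ℝ) ℂ) : Integrable (FT3 φ) := by
  obtain ⟨C, hC⟩ := exists_one_add_dot3_pow_mul_norm_FT3_le φ 3
  refine (integrable_inv_one_add_dot3_pow.const_mul C).mono'
    (continuous_FT3 φ).aestronglyMeasurable (Eventually.of_forall fun ξ => ?_)
  have := dot3_self_nonneg ξ
  rw [← div_eq_mul_inv, le_div_iff₀ (by positivity), mul_comm]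
  exact hC ξ

lemma integrable_one_add_dot3_rpow_mul_norm_FT3_sq (s : ℝ) (φ : SchwartzMap (ℝ × ℝ × ℝ) ℂ) :
    Integrable fun ξ => (1 + dot3 ξ ξ) ^ s * ‖FT3 φ ξ‖ ^ 2 := by
  obtain ⟨n, hn⟩ := exists_nat_ge s
  obtain ⟨C, hC⟩ := exists_one_add_dot3_pow_mul_norm_FT3_le φ 3
  obtain ⟨D, hD⟩ := exists_one_add_dot3_pow_mul_norm_FT3_le φ n
  refine (integrable_inv_one_add_dot3_pow.const_mul (D * C)).mono' ?_
    (Eventually.of_forall fun ξ => ?_)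
  · exact (((continuous_dot3_self.measurable.const_add 1).pow_const s).mul
      ((continuous_FT3 φ).norm.measurable.pow_const 2)).aestronglyMeasurable
  have h0 := dot3_self_nonneg ξ
  have hs : (1 + dot3 ξ ξ) ^ s ≤ (1 + dot3 ξ ξ) ^ n := by
    rw [← Real.rpow_natCast]
    exact Real.rpow_le_rpow_of_exponent_le (by linarith) hn
  rw [Real.norm_of_nonneg (by positivity), ← div_eq_mul_inv, le_div_iff₀ (by positivity)]
  have h1 := hC ξ
  have h2 := hD ξ
  calc _ ≤ (1 + dot3 ξ ξ) ^ n * ‖FT3 φ ξ‖ ^ 2 * (1 + dot3 ξ ξ) ^ 3 := by gcongr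
    _ = ((1 + dot3 ξ ξ) ^ n * ‖FT3 φ ξ‖) * ((1 + dot3 ξ ξ) ^ 3 * ‖FT3 φ ξ‖) := by ring
    _ ≤ _ := mul_le_mul h2 h1 (by positivity) ((by positivity : (0 : ℝ) ≤ (1 + dot3 ξ ξ) ^ n * ‖FT3 φ ξ‖).trans h2)

lemma continuous_U3 (φ : SchwartzMap (ℝ × ℝ × ℝ) ℂ) :
    Continuous fun q : ℝ × (ℝ × ℝ × ℝ) => U3 φ q.1 q.2 := by
  have hω := continuous_omega3
  have hF := continuous_FT3 φ
  unfold U3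
  refine continuous_of_dominated (bound := fun ξ => ‖FT3 φ ξ‖) (fun q => ?_) (fun q => ?_)
    (integrable_FT3 φ).norm (Eventually.of_forall fun ξ => ?_)
  · exact (integrable_phase_mul (integrable_FT3 φ) q.1 q.2).aestronglyMeasurable
  · refine Eventually.of_forall fun ξ => ?_
    rw [norm_mul, mul_comm Complex.I, Complex.norm_exp_ofReal_mul_I, one_mul]
  · have : Continuous fun q : ℝ × (ℝ × ℝ × ℝ) => dot3 q.2 ξ :=
      continuous_dot3.comp (continuous_snd.prodMk continuous_const)
    fun_prop

lemma lintegral_iSup_le_of_selection {P : Type*} [TopologicalSpace P]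
    [TopologicalSpace.SeparableSpace P] [Nonempty P] [MeasurableSpace P] {f : ℝ → P → ENNReal}
    (hf : Measurable (Function.uncurry f)) (hc : ∀ x, Continuous (f x)) {B : ENNReal}
    (hB : ∀ p : ℝ → P, Measurable p → ∫⁻ x, f x (p x) ≤ B) :
    ∫⁻ x, ⨆ p, f x p ≤ B := by
  set q := TopologicalSpace.denseSeq P
  have hfp : ∀ {p : ℝ → P}, Measurable p → Measurable fun x => f x (p x) := fun hp =>
    hf.comp (measurable_id.prodMk hp)
  have hsel : ∀ n : ℕ, ∃ p : ℝ → P, Measurable p ∧ ∀ k ≤ n, ∀ x, f x (q k) ≤ f x (p x) := by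
    intro n
    induction n with
    | zero =>
      refine ⟨fun _ => q 0, measurable_const, fun k hk x => ?_⟩
      rw [Nat.le_zero.1 hk]
    | succ n ih =>
      obtain ⟨p, hp, hpk⟩ := ih
      classical
      refine ⟨fun x => if f x (p x) < f x (q (n + 1)) then q (n + 1) else p x,
        Measurable.ite (measurableSet_lt (hfp hp) (hfp measurable_const)) measurable_const hp,
        fun k hk x => ?_⟩
      dsimp only
      rcases Nat.le_succ_iff.1 hk with hk | rfl
      · split_ifs with h
        · exact (hpk k hk x).trans h.le
        · exact hpk k hk x
      · split_ifs with h
        · exact le_rfl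
        · exact not_lt.1 h
  have hsup : ∀ x, ⨆ p, f x p ≤ ⨆ n, ⨆ k ≤ n, f x (q k) := fun x => by
    refine iSup_le fun p => ?_
    refine (TopologicalSpace.denseRange_denseSeq P).induction_on p
      (isClosed_le (hc x) continuous_const) fun n => ?_
    exact le_iSup_of_le n (le_iSup₂_of_le n le_rfl le_rfl)
  calc ∫⁻ x, ⨆ p, f x p ≤ ∫⁻ x, ⨆ n, ⨆ k ≤ n, f x (q k) := lintegral_mono hsup
    _ = ⨆ n, ∫⁻ x, ⨆ k ≤ n, f x (q k) := by
        refine lintegral_iSup (fun n => ?_) fun n m hnm x => ?_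
        · exact Measurable.iSup fun k => Measurable.iSup fun _ => hfp measurable_const
        · exact biSup_mono fun k hk => hk.trans hnm
    _ ≤ B := by
        refine iSup_le fun n => ?_
        obtain ⟨p, hp, hpk⟩ := hsel n
        exact (lintegral_mono fun x => iSup₂_le fun k hk => hpk k hk x).trans (hB p hp)

lemma lintegral_rpow_mul_exp_neg_mul_Ioi {a r : ℝ} (ha : 0 < a) (hr : 0 < r) :
    ∫⁻ l in Set.Ioi (0 : ℝ), ENNReal.ofReal (l ^ (a - 1) * rexp (-(r * l))) =
      ENNReal.ofReal ((1 / r) ^ a * Real.Gamma a) := by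
  have h := Real.integral_rpow_mul_exp_neg_mul_Ioi ha hr
  rw [← h, ofReal_integral_eq_lintegral_ofReal]
  · refine Integrable.of_integral_ne_zero ?_
    rw [h]
    have := Real.Gamma_pos_of_pos ha
    positivity
  · refine (ae_restrict_iff' measurableSet_Ioi).2 (Eventually.of_forall fun l hl => ?_)
    have : (0 : ℝ) < l := hl
    simp only [Pi.zero_apply]
    positivity

lemma phase_mul_conj_phase (x x' : ℝ × ℝ × ℝ) (t t' : ℝ) (ξ : ℝ × ℝ × ℝ) :
    Complex.exp (Complex.I * ((dot3 x ξ + t * omega3 ξ : ℝ) : ℂ)) *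
        starRingEnd ℂ (Complex.exp (Complex.I * ((dot3 x' ξ + t' * omega3 ξ : ℝ) : ℂ))) =
      Complex.exp (Complex.I * ((dot3 (x - x') ξ + (t - t') * omega3 ξ : ℝ) : ℂ)) := by
  rw [← Complex.exp_conj, map_mul, Complex.conj_I, Complex.conj_ofReal, ← Complex.exp_add]
  congr 1
  simp only [dot3, Prod.fst_sub, Prod.snd_sub]
  push_cast
  ring

/-- Points `(x, y, z)` and times `t`, with `(y, z, t) = p x` selected measurably. -/
def selectedPhase (p : ℝ → ℝ × ℝ × ℝ) (x : ℝ) (ξ : ℝ × ℝ × ℝ) : ℂ :=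
  Complex.exp (Complex.I *
    ((dot3 (x, (p x).1, (p x).2.1) ξ + (p x).2.2 * omega3 ξ : ℝ) : ℂ))

lemma norm_selectedPhase (p : ℝ → ℝ × ℝ × ℝ) (x : ℝ) (ξ : ℝ × ℝ × ℝ) :
    ‖selectedPhase p x ξ‖ = 1 := by
  rw [selectedPhase, mul_comm, Complex.norm_exp_ofReal_mul_I]

lemma measurable_selectedPhase {p : ℝ → ℝ × ℝ × ℝ} (hp : Measurable p) :
    Measurable (Function.uncurry (selectedPhase p)) := by
  have hp' : Measurable fun q : ℝ × ℝ × ℝ × ℝ => p q.1 := hp.comp measurable_fst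
  have h1 : Measurable fun q : ℝ × ℝ × ℝ × ℝ => dot3 (q.1, (p q.1).1, (p q.1).2.1) q.2 :=
    continuous_dot3.measurable.comp
      ((measurable_fst.prodMk (hp'.fst.prodMk hp'.snd.fst)).prodMk measurable_snd)
  have h2 : Measurable fun q : ℝ × ℝ × ℝ × ℝ => (p q.1).2.2 * omega3 q.2 :=
    hp'.snd.snd.mul (continuous_omega3.measurable.comp measurable_snd)
  exact Complex.measurable_exp.comp
    ((Complex.measurable_ofReal.comp (h1.add h2)).const_mul Complex.I)

lemma exists_lintegral_bessel_mul_sq_le {s : ℝ} (hs : 1 < s) :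
    ∃ K : ℝ, 0 < K ∧ ∀ p : ℝ → ℝ × ℝ × ℝ, Measurable p →
      (∀ x, (p x).2.2 ∈ Set.Icc (0 : ℝ) 1) → ∀ g : ℝ → ℂ, Measurable g → Integrable g →
      ∫⁻ ξ, ENNReal.ofReal ((1 / (1 + dot3 ξ ξ)) ^ s * Real.Gamma s) *
        ‖∫ x, selectedPhase p x ξ * g x‖ₑ ^ 2 ≤ ENNReal.ofReal K * ∫⁻ x, ‖g x‖ₑ ^ 2 := by
  set θ : ℝ := min ((s - 1) / 3) (1 / 2)
  have hθ : 0 < θ := lt_min (by linarith) (by norm_num)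
  have hθs : θ ≤ (s - 1) / 3 := min_le_left _ _
  have hθ1 : θ < 1 := (min_le_right _ _).trans_lt (by norm_num)
  obtain ⟨C, hC, hmaj⟩ := exists_gaussKernel_majorant hθ hθ1
  have hs1 : 0 < s - 1 := by linarith
  have hs2 : 0 < s - 1 - 3 * θ / 2 := by linarith
  have hΓ1 := Real.Gamma_pos_of_pos hs1
  have hΓ2 := Real.Gamma_pos_of_pos hs2
  refine ⟨C * (Real.Gamma (s - 1) + Real.Gamma (s - 1 - 3 * θ / 2)), by positivity,
    fun p hp hpt g hg hgi => ?_⟩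
  set G : ℝ × ℝ × ℝ → ENNReal := fun ξ => ‖∫ x, selectedPhase p x ξ * g x‖ₑ ^ 2 with hGdef
  have hG : Measurable G :=
    (measurable_integral_mul (measurable_selectedPhase hp) hg).enorm.pow_const 2
  set N : ENNReal := ∫⁻ x, ‖g x‖ₑ ^ 2
  have hd : Measurable fun ξ : ℝ × ℝ × ℝ => dot3 ξ ξ := continuous_dot3_self.measurable
  have hlevel : ∀ l : ℝ, 0 < l → ∫⁻ ξ, ENNReal.ofReal (rexp (-l * dot3 ξ ξ)) * G ξ ≤
      ENNReal.ofReal (C * (l ^ (-1 : ℝ) + l ^ (-1 - 3 * θ / 2))) * N := by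
    intro l hl
    obtain ⟨h, hh, hh0, hhint, hhk⟩ := hmaj l hl
    refine (lintegral_weight_mul_sq_le (measurable_selectedPhase hp)
      (fun x ξ => (norm_selectedPhase p x ξ).le) (integrable_exp_neg_mul_dot3 hl)
      (fun ξ => (Real.exp_pos _).le) hh hh0 (fun x x' hx => ?_) hg hgi).trans ?_
    · have e : ∀ ξ, selectedPhase p x ξ * starRingEnd ℂ (selectedPhase p x' ξ) =
          Complex.exp (Complex.I * ((dot3 (x - x', (p x).1 - (p x').1, (p x).2.1 - (p x').2.1) ξ +
            ((p x).2.2 - (p x').2.2) * omega3 ξ : ℝ) : ℂ)) := fun ξ =>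
        phase_mul_conj_phase _ _ _ _ _
      simp only [e]
      refine hhk ((p x).2.2 - (p x').2.2) _ _ _ ?_ (sub_ne_zero.2 hx)
      obtain ⟨a1, a2⟩ := hpt x
      obtain ⟨b1, b2⟩ := hpt x'
      exact abs_le.2 ⟨by linarith, by linarith⟩
    · gcongr
  have hsplit : ∀ ξ, ENNReal.ofReal ((1 / (1 + dot3 ξ ξ)) ^ s * Real.Gamma s) * G ξ =
      ∫⁻ l in Set.Ioi (0 : ℝ), ENNReal.ofReal (l ^ (s - 1) * rexp (-l)) *
        (ENNReal.ofReal (rexp (-l * dot3 ξ ξ)) * G ξ) := by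
    intro ξ
    have h0 := dot3_self_nonneg ξ
    rw [← lintegral_rpow_mul_exp_neg_mul_Ioi (by linarith) (by linarith),
      ← lintegral_mul_const _ (by fun_prop)]
    refine lintegral_congr fun l => ?_
    rw [← mul_assoc, ← ENNReal.ofReal_mul' (Real.exp_pos _).le, mul_assoc (l ^ (s - 1)),
      ← Real.exp_add]
    congr 4
    ring
  calc _ = ∫⁻ ξ, ∫⁻ l in Set.Ioi (0 : ℝ), ENNReal.ofReal (l ^ (s - 1) * rexp (-l)) *
        (ENNReal.ofReal (rexp (-l * dot3 ξ ξ)) * G ξ) := lintegral_congr hsplit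
    _ = ∫⁻ l in Set.Ioi (0 : ℝ), ENNReal.ofReal (l ^ (s - 1) * rexp (-l)) *
        ∫⁻ ξ, ENNReal.ofReal (rexp (-l * dot3 ξ ξ)) * G ξ := by
        rw [lintegral_lintegral_swap]
        · refine lintegral_congr fun l => ?_
          rw [lintegral_const_mul]
          exact ((hd.const_mul (-l)).exp.ennreal_ofReal).mul hG
        · have hm1 : Measurable fun q : (ℝ × ℝ × ℝ) × ℝ => q.2 ^ (s - 1) * rexp (-q.2) := by
            fun_prop
          have hm2 : Measurable fun q : (ℝ × ℝ × ℝ) × ℝ => rexp (-q.2 * dot3 q.1 q.1) :=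
            (measurable_snd.neg.mul (hd.comp measurable_fst)).exp
          exact (hm1.ennreal_ofReal.mul
            (hm2.ennreal_ofReal.mul (hG.comp measurable_fst))).aemeasurable
    _ ≤ ∫⁻ l in Set.Ioi (0 : ℝ), (ENNReal.ofReal C *
        (ENNReal.ofReal (l ^ (s - 1 - 1) * rexp (-(1 * l))) +
          ENNReal.ofReal (l ^ (s - 1 - 3 * θ / 2 - 1) * rexp (-(1 * l))))) * N := by
        refine setLIntegral_mono' measurableSet_Ioi fun l (hl : 0 < l) => ?_
        refine (mul_le_mul_right (hlevel l hl) _).trans_eq ?_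
        rw [← mul_assoc, ← ENNReal.ofReal_mul (by positivity),
          ← ENNReal.ofReal_add (by positivity) (by positivity), ← ENNReal.ofReal_mul hC.le]
        congr 2
        have e1 : l ^ (s - 1 - 1) = l ^ (s - 1) * l ^ (-1 : ℝ) := by
          rw [← Real.rpow_add hl]; ring_nf
        have e2 : l ^ (s - 1 - 3 * θ / 2 - 1) = l ^ (s - 1) * l ^ (-1 - 3 * θ / 2) := by
          rw [← Real.rpow_add hl]; ring_nf
        rw [e1, e2, one_mul]
        ring
    _ = _ := by
        rw [lintegral_mul_const _ (by fun_prop), lintegral_const_mul _ (by fun_prop),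
          lintegral_add_left (by fun_prop), lintegral_rpow_mul_exp_neg_mul_Ioi hs1 one_pos,
          lintegral_rpow_mul_exp_neg_mul_Ioi hs2 one_pos, div_one, Real.one_rpow, Real.one_rpow,
          one_mul, one_mul, ← ENNReal.ofReal_add hΓ1.le hΓ2.le, ← ENNReal.ofReal_mul hC.le]

lemma exists_lintegral_selected_U3_sq_le {s : ℝ} (hs : 1 < s) :
    ∃ K : ℝ, 0 < K ∧ ∀ p : ℝ → ℝ × ℝ × ℝ, Measurable p →
      (∀ x, (p x).2.2 ∈ Set.Icc (0 : ℝ) 1) → ∀ φ : SchwartzMap (ℝ × ℝ × ℝ) ℂ,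
      ∫⁻ x, ‖U3 φ (p x).2.2 (x, (p x).1, (p x).2.1)‖ₑ ^ 2 ≤
        ENNReal.ofReal (K * ∫ ξ, (1 + dot3 ξ ξ) ^ s * ‖FT3 φ ξ‖ ^ 2) := by
  obtain ⟨K, hK, hdual⟩ := exists_lintegral_bessel_mul_sq_le hs
  have hΓ := Real.Gamma_pos_of_pos (by linarith : 0 < s)
  refine ⟨K * (Real.Gamma s)⁻¹, by positivity, fun p hp hpt φ => ?_⟩
  have hd : Measurable fun ξ : ℝ × ℝ × ℝ => dot3 ξ ξ := continuous_dot3_self.measurable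
  have hpos : ∀ ξ : ℝ × ℝ × ℝ, 0 < 1 + dot3 ξ ξ := fun ξ => by linarith [dot3_self_nonneg ξ]
  have hw : Measurable fun ξ : ℝ × ℝ × ℝ =>
      ENNReal.ofReal ((1 / (1 + dot3 ξ ξ)) ^ s * Real.Gamma s) :=
    ((((hd.const_add 1).const_div 1).pow_const s).mul_const _).ennreal_ofReal
  have hw0 : ∀ ξ : ℝ × ℝ × ℝ, 0 < (1 / (1 + dot3 ξ ξ)) ^ s * Real.Gamma s := fun ξ => by
    have := hpos ξ
    positivity
  refine (lintegral_sq_le_of_dual_bound (measurable_selectedPhase hp)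
    (fun x ξ => (norm_selectedPhase p x ξ).le) (integrable_FT3 φ) hw.aemeasurable
    (fun ξ => (ENNReal.ofReal_pos.2 (hw0 ξ)).ne') (fun ξ => ENNReal.ofReal_ne_top)
    (hdual p hp hpt)).trans_eq ?_
  have h_int := integrable_one_add_dot3_rpow_mul_norm_FT3_sq s φ
  rw [mul_assoc, ENNReal.ofReal_mul hK.le, ENNReal.ofReal_mul (by positivity),
    ofReal_integral_eq_lintegral_ofReal h_int (Eventually.of_forall fun ξ => by
      have := hpos ξ
      simp only [Pi.zero_apply]
      positivity)]
  congr 1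
  rw [← lintegral_const_mul' _ _ ENNReal.ofReal_ne_top]
  refine lintegral_congr fun ξ => ?_
  have := hpos ξ
  rw [← ENNReal.ofReal_inv_of_pos (hw0 ξ), ← ofReal_norm, ← ENNReal.ofReal_pow
    (norm_nonneg _), ← ENNReal.ofReal_mul (by have := hw0 ξ; positivity),
    ← ENNReal.ofReal_mul (by positivity), mul_inv, one_div, Real.inv_rpow this.le, inv_inv]
  congr 1
  ring

lemma norm_U3_le (φ : SchwartzMap (ℝ × ℝ × ℝ) ℂ) (t : ℝ) (x : ℝ × ℝ × ℝ) :
    ‖U3 φ t x‖ ≤ ∫ ξ, ‖FT3 φ ξ‖ := by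
  refine (norm_integral_le_integral_norm _).trans_eq (integral_congr_ae
    (Eventually.of_forall fun ξ => ?_))
  simp only [norm_mul]
  rw [mul_comm Complex.I, Complex.norm_exp_ofReal_mul_I, one_mul]

lemma iSup₃_norm_sq_le {T : ℝ} (hT : 0 < T) (φ : SchwartzMap (ℝ × ℝ × ℝ) ℂ) (x : ℝ) :
    ENNReal.ofReal ((⨆ (y : ℝ) (z : ℝ) (t : Set.Icc (0 : ℝ) T), ‖U3 φ t (x, y, z)‖) ^ 2) ≤
      ⨆ p : ℝ × ℝ × Set.Icc (0 : ℝ) T, ‖U3 φ p.2.2 (x, p.1, p.2.1)‖ₑ ^ 2 := by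
  set S := ⨆ p : ℝ × ℝ × Set.Icc (0 : ℝ) T, ‖U3 φ p.2.2 (x, p.1, p.2.1)‖ₑ ^ 2
  have : Nonempty (Set.Icc (0 : ℝ) T) := ⟨⟨0, le_rfl, hT.le⟩⟩
  have hle : ∀ p : ℝ × ℝ × Set.Icc (0 : ℝ) T, ENNReal.ofReal (‖U3 φ p.2.2 (x, p.1, p.2.1)‖ ^ 2) ≤ S :=
    fun p => by
      rw [ENNReal.ofReal_pow (norm_nonneg _), ofReal_norm]
      exact le_iSup (fun p : ℝ × ℝ × Set.Icc (0 : ℝ) T => ‖U3 φ p.2.2 (x, p.1, p.2.1)‖ₑ ^ 2) p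
  have hS : S ≠ ⊤ := by
    refine ne_top_of_le_ne_top (b := ENNReal.ofReal ((∫ ξ, ‖FT3 φ ξ‖) ^ 2)) ENNReal.ofReal_ne_top
      (iSup_le fun p => ?_)
    rw [← ofReal_norm, ← ENNReal.ofReal_pow (norm_nonneg _)]
    gcongr
    exact norm_U3_le φ _ _
  rw [← ENNReal.ofReal_toReal hS]
  refine ENNReal.ofReal_le_ofReal ?_
  have h0 : 0 ≤ ⨆ (y : ℝ) (z : ℝ) (t : Set.Icc (0 : ℝ) T), ‖U3 φ t (x, y, z)‖ :=
    Real.iSup_nonneg fun y => Real.iSup_nonneg fun z => Real.iSup_nonneg fun t => norm_nonneg _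
  rw [← Real.le_sqrt h0 ENNReal.toReal_nonneg]
  refine ciSup_le fun y => ciSup_le fun z => ciSup_le fun t => ?_
  refine Real.le_sqrt_of_sq_le ?_
  exact (ENNReal.ofReal_le_iff_le_toReal hS).1 (hle (y, z, t))

lemma continuous_enorm_U3_sq (φ : SchwartzMap (ℝ × ℝ × ℝ) ℂ) (T : ℝ) :
    Continuous fun q : ℝ × ℝ × ℝ × Set.Icc (0 : ℝ) T =>
      ‖U3 φ q.2.2.2 (q.1, q.2.1, q.2.2.1)‖ₑ ^ 2 := by
  have h : Continuous fun q : ℝ × ℝ × ℝ × Set.Icc (0 : ℝ) T =>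
      ((q.2.2.2 : ℝ), (q.1, q.2.1, q.2.2.1)) := by fun_prop
  exact (ENNReal.continuous_pow 2).comp ((continuous_U3 φ).comp h).enorm

lemma continuous_enorm_U3_sq_right (φ : SchwartzMap (ℝ × ℝ × ℝ) ℂ) (T x : ℝ) :
    Continuous fun p : ℝ × ℝ × Set.Icc (0 : ℝ) T => ‖U3 φ p.2.2 (x, p.1, p.2.1)‖ₑ ^ 2 := by
  have h : Continuous fun p : ℝ × ℝ × Set.Icc (0 : ℝ) T =>
      ((p.2.2 : ℝ), (x, p.1, p.2.1)) := by fun_prop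
  exact (ENNReal.continuous_pow 2).comp ((continuous_U3 φ).comp h).enorm

lemma exists_lintegral_iSup_U3_sq_le {s : ℝ} (hs : 1 < s) :
    ∃ K : ℝ, 0 < K ∧ ∀ T : ℝ, 0 < T → T < 1 → ∀ φ : SchwartzMap (ℝ × ℝ × ℝ) ℂ,
      ∫⁻ x, ⨆ p : ℝ × ℝ × Set.Icc (0 : ℝ) T, ‖U3 φ p.2.2 (x, p.1, p.2.1)‖ₑ ^ 2 ≤
        ENNReal.ofReal (K * ∫ ξ, (1 + dot3 ξ ξ) ^ s * ‖FT3 φ ξ‖ ^ 2) := by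
  obtain ⟨K, hK, hsel⟩ := exists_lintegral_selected_U3_sq_le hs
  refine ⟨K, hK, fun T hT hT1 φ => ?_⟩
  have : Nonempty (Set.Icc (0 : ℝ) T) := ⟨⟨0, le_rfl, hT.le⟩⟩
  have hU := (continuous_enorm_U3_sq φ T).measurable
  refine lintegral_iSup_le_of_selection
    (f := fun x (p : ℝ × ℝ × Set.Icc (0 : ℝ) T) => ‖U3 φ p.2.2 (x, p.1, p.2.1)‖ₑ ^ 2)
    hU (continuous_enorm_U3_sq_right φ T) fun p hp => ?_
  have hp' : Measurable fun x => ((p x).1, (p x).2.1, ((p x).2.2 : ℝ)) :=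
    hp.fst.prodMk (hp.snd.fst.prodMk (measurable_subtype_coe.comp hp.snd.snd))
  exact hsel _ hp' (fun x => ⟨(p x).2.2.2.1, (p x).2.2.2.2.trans hT1.le⟩) φ

/-- Proposition 3.5: for s > 1, ‖U(t)φ‖_{L²_x L^∞_{yzT}} ≲ ‖φ‖_{H^s}, uniformly in T ∈ (0,1). -/
theorem maximal_Hs (s : ℝ) (hs : 1 < s) :
    ∃ C : ℝ, 0 < C ∧ ∀ T : ℝ, 0 < T → T < 1 → ∀ φ : SchwartzMap (ℝ × ℝ × ℝ) ℂ,
      Real.sqrt (∫ x : ℝ, (⨆ (y : ℝ) (z : ℝ) (t : Set.Icc (0:ℝ) T),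
          ‖U3 (⇑φ) (t : ℝ) (x, y, z)‖) ^ 2)
        ≤ C * HsNorm s (⇑φ) := by
  obtain ⟨K, hK, hsup⟩ := exists_lintegral_iSup_U3_sq_le hs
  refine ⟨√K, Real.sqrt_pos.2 hK, fun T hT hT1 φ => ?_⟩
  have : Nonempty (Set.Icc (0 : ℝ) T) := ⟨⟨0, le_rfl, hT.le⟩⟩
  have hQ : 0 ≤ ∫ ξ, (1 + dot3 ξ ξ) ^ s * ‖FT3 φ ξ‖ ^ 2 := integral_nonneg fun ξ => by
    have := dot3_self_nonneg ξ
    positivity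
  rw [HsNorm, ← Real.sqrt_mul hK.le]
  refine Real.sqrt_le_sqrt ?_
  by_cases h_int : Integrable fun x : ℝ =>
      (⨆ (y : ℝ) (z : ℝ) (t : Set.Icc (0 : ℝ) T), ‖U3 φ t (x, y, z)‖) ^ 2
  swap
  · rw [integral_undef h_int]
    positivity
  rw [← ENNReal.ofReal_le_ofReal_iff (by positivity),
    ofReal_integral_eq_lintegral_ofReal h_int (Eventually.of_forall fun x => sq_nonneg _)]
  exact (lintegral_mono fun x => iSup₃_norm_sq_le hT φ x).trans (hsup T hT hT1 φ)
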